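/- Let $H$ be a nonempty finite simple graph with chromatic number $\chi(H)$, and let $\mathcal{G}$ be a family of graphs on the common vertex set $\{1,\ldots,n\}$ such that for every $G_1, G_2 \in \mathcal{G}$, the intersection $G_1 \cap G_2$ contains a subgraph isomorphic to $H$. Then $|\mathcal{G}| \leq 2^{\binom{n}{2}-(\chi(H)-1)}$. -/

import Mathlib

open Finset in
/-- Superadditivity of the geometric mean. -/
lemma aux_mahler {ι : Type*} (s : Finset ι) (a b : ι → ℝ) (ha : ∀ i ∈ s, 0 ≤ a i)
    (hb : ∀ i ∈ s, 0 ≤ b i) (k : ℕ) (hk : 0 < k) (hs : s.card = k) :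
    ∏ i ∈ s, (a i) ^ ((k : ℝ)⁻¹) + ∏ i ∈ s, (b i) ^ ((k : ℝ)⁻¹)
      ≤ ∏ i ∈ s, (a i + b i) ^ ((k : ℝ)⁻¹) := by
  have hk0 : (k : ℝ) ≠ 0 := by positivity
  by_cases hz : ∃ i ∈ s, a i + b i = 0
  · obtain ⟨i, hi, h0⟩ := hz
    have h1 : a i = 0 := by linarith [ha i hi, hb i hi]
    have h2 : b i = 0 := by linarith [ha i hi, hb i hi]
    have hki : (k : ℝ)⁻¹ ≠ 0 := inv_ne_zero hk0
    rw [Finset.prod_eq_zero hi (by rw [h1, Real.zero_rpow hki]),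
      Finset.prod_eq_zero hi (by rw [h2, Real.zero_rpow hki]),
      Finset.prod_eq_zero hi (by rw [h0, Real.zero_rpow hki])]
    simp
  push Not at hz
  have hpos : ∀ i ∈ s, 0 < a i + b i := fun i hi =>
    lt_of_le_of_ne (add_nonneg (ha i hi) (hb i hi)) (Ne.symm (hz i hi))
  have hw : ∑ _i ∈ s, (k : ℝ)⁻¹ = 1 := by
    rw [Finset.sum_const, hs, nsmul_eq_mul, mul_inv_cancel₀ hk0]
  have key : ∀ f : ι → ℝ, (∀ i ∈ s, 0 ≤ f i) →
      ∏ i ∈ s, (f i) ^ ((k : ℝ)⁻¹) ≤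
        (∑ i ∈ s, (k : ℝ)⁻¹ * (f i / (a i + b i))) * ∏ i ∈ s, (a i + b i) ^ ((k : ℝ)⁻¹) := by
    intro f hf
    have h1 := Real.geom_mean_le_arith_mean_weighted s (fun _ => (k : ℝ)⁻¹)
      (fun i => f i / (a i + b i)) (fun i _ => by positivity) hw
      (fun i hi => div_nonneg (hf i hi) (hpos i hi).le)
    have h2 : ∏ i ∈ s, (f i) ^ ((k : ℝ)⁻¹) =
        (∏ i ∈ s, (f i / (a i + b i)) ^ ((k : ℝ)⁻¹)) * ∏ i ∈ s, (a i + b i) ^ ((k : ℝ)⁻¹) := by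
      rw [← Finset.prod_mul_distrib]
      refine Finset.prod_congr rfl fun i hi => ?_
      rw [← Real.mul_rpow (div_nonneg (hf i hi) (hpos i hi).le) (hpos i hi).le,
        div_mul_cancel₀ _ (hpos i hi).ne']
    rw [h2]
    exact mul_le_mul_of_nonneg_right h1
      (Finset.prod_nonneg fun i hi => Real.rpow_nonneg (hpos i hi).le _)
  calc _ ≤ _ := add_le_add (key a ha) (key b hb)
    _ = (∑ _i ∈ s, (k : ℝ)⁻¹) * ∏ i ∈ s, (a i + b i) ^ ((k : ℝ)⁻¹) := by
      rw [← add_mul, ← Finset.sum_add_distrib]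
      congr 1
      refine Finset.sum_congr rfl fun i hi => ?_
      rw [← mul_add, ← add_div, div_self (hpos i hi).ne', mul_one]
    _ = _ := by rw [hw, one_mul]

/-- Natural number form of the step inequality. -/
lemma aux_step {ι : Type*} (s : Finset ι) (a b : ι → ℕ) (k : ℕ) (hk : 0 < k) (hs : s.card = k)
    (x y P : ℕ) (hx : x ^ k ≤ P * ∏ i ∈ s, a i) (hy : y ^ k ≤ P * ∏ i ∈ s, b i) :
    (x + y) ^ k ≤ P * ∏ i ∈ s, (a i + b i) := by
  have hk0 : k ≠ 0 := hk.ne'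
  have root : ∀ (z : ℕ) (f : ι → ℕ), z ^ k ≤ P * ∏ i ∈ s, f i →
      (z : ℝ) ≤ (P : ℝ) ^ ((k : ℝ)⁻¹) * ∏ i ∈ s, ((f i : ℝ)) ^ ((k : ℝ)⁻¹) := by
    intro z f hz
    have hz' : (z : ℝ) ^ k ≤ P * ∏ i ∈ s, (f i : ℝ) := by exact_mod_cast hz
    have := Real.rpow_le_rpow (z := (k : ℝ)⁻¹) (by positivity) hz' (by positivity)
    rwa [Real.pow_rpow_inv_natCast (by positivity) hk0,
      Real.mul_rpow (by positivity) (Finset.prod_nonneg fun i _ => by positivity),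
      ← Real.finsetProd_rpow _ _ (fun i _ => by positivity)] at this
  have h1 := root x a hx
  have h2 := root y b hy
  have h3 := aux_mahler s (fun i => (a i : ℝ)) (fun i => (b i : ℝ)) (fun i _ => by positivity)
    (fun i _ => by positivity) k hk hs
  have h4 : ((x : ℝ) + y) ≤ (P : ℝ) ^ ((k : ℝ)⁻¹) *
      ∏ i ∈ s, ((a i : ℝ) + b i) ^ ((k : ℝ)⁻¹) := by
    have : (0 : ℝ) ≤ (P : ℝ) ^ ((k : ℝ)⁻¹) := by positivity
    nlinarith [mul_le_mul_of_nonneg_left h3 this]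
  have h5 := pow_le_pow_left₀ (by positivity) h4 k
  rw [Real.finsetProd_rpow _ _ (fun i _ => by positivity), mul_pow,
    Real.rpow_inv_natCast_pow (by positivity) hk0,
    Real.rpow_inv_natCast_pow (Finset.prod_nonneg fun i _ => by positivity) hk0] at h5
  exact_mod_cast h5

/-- Shearer's lemma, product form. -/
lemma aux_shearer {α ι : Type*} [DecidableEq α] [Fintype ι] (A : ι → Finset α)
    (k : ℕ) (hk : 0 < k) (S : Finset α) :
    (∀ x ∈ S, (Finset.univ.filter fun i => x ∈ A i).card = k) →
    ∀ F : Finset (Finset α), (∀ s ∈ F, s ⊆ S) →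
      F.card ^ k ≤ ∏ i, (F.image (fun s => s ∩ A i)).card := by
  classical
  induction S using Finset.induction_on with
  | empty =>
    intro _ F hF
    rcases F.eq_empty_or_nonempty with rfl | hne
    · simp [hk.ne']
    · have h1 : F.card ≤ 1 := Finset.card_le_one.2 fun a ha b hb => by
        rw [Finset.subset_empty.1 (hF a ha), Finset.subset_empty.1 (hF b hb)]
      calc F.card ^ k ≤ 1 ^ k := Nat.pow_le_pow_left h1 k
        _ = 1 := one_pow k
        _ ≤ _ := Nat.one_le_iff_ne_zero.2 (Finset.prod_ne_zero_iff.2 fun i _ =>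
          (Finset.card_pos.2 (hne.image _)).ne')
  | insert x S hxS ih =>
    intro hA F hF
    have ih' := ih (fun y hy => hA y (Finset.mem_insert_of_mem hy))
    have h0 := ih' (F.nonMemberSubfamily x) (by
      intro s hs
      rw [Finset.mem_nonMemberSubfamily] at hs
      exact (Finset.subset_insert_iff_of_notMem hs.2).1 (hF s hs.1))
    have h1 := ih' (F.memberSubfamily x) (by
      intro s hs
      rw [Finset.mem_memberSubfamily] at hs
      exact (Finset.subset_insert_iff_of_notMem hs.2).1
        ((Finset.subset_insert _ _).trans (hF _ hs.1)))
    set T : Finset ι := Finset.univ.filter fun i => x ∈ A i with hT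
    set U : Finset ι := Finset.univ.filter fun i => ¬ x ∈ A i with hU
    have split : ∀ f : ι → ℕ, ∏ i, f i = (∏ i ∈ U, f i) * ∏ i ∈ T, f i := fun f => by
      rw [mul_comm]; exact (Finset.prod_filter_mul_prod_filter_not _ _ _).symm
    rw [split] at h0 h1 ⊢
    have out : ∀ i ∈ U, ((F.nonMemberSubfamily x).image (fun s => s ∩ A i)).card ≤
          (F.image (fun s => s ∩ A i)).card ∧
        ((F.memberSubfamily x).image (fun s => s ∩ A i)).card ≤
          (F.image (fun s => s ∩ A i)).card := by
      intro i hi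
      have hxi : x ∉ A i := (Finset.mem_filter.1 hi).2
      constructor
      · refine Finset.card_le_card (Finset.image_subset_image ?_)
        intro s hs
        exact (Finset.mem_nonMemberSubfamily.1 hs).1
      · refine Finset.card_le_card ?_
        intro t ht
        obtain ⟨s, hs, rfl⟩ := Finset.mem_image.1 ht
        refine Finset.mem_image.2 ⟨insert x s, (Finset.mem_memberSubfamily.1 hs).1, ?_⟩
        exact Finset.insert_inter_of_notMem hxi
    have inn : ∀ i ∈ T, ((F.memberSubfamily x).image (fun s => s ∩ A i)).card +
          ((F.nonMemberSubfamily x).image (fun s => s ∩ A i)).card ≤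
          (F.image (fun s => s ∩ A i)).card := by
      intro i hi
      have hxi : x ∈ A i := (Finset.mem_filter.1 hi).2
      rw [← Finset.card_memberSubfamily_add_card_nonMemberSubfamily x
        (F.image (fun s => s ∩ A i))]
      refine add_le_add (Finset.card_le_card ?_) (Finset.card_le_card ?_)
      · intro t ht
        obtain ⟨s, hs, rfl⟩ := Finset.mem_image.1 ht
        rw [Finset.mem_memberSubfamily] at hs ⊢
        refine ⟨Finset.mem_image.2 ⟨insert x s, hs.1, ?_⟩, fun h => hs.2 (Finset.mem_inter.1 h).1⟩
        exact Finset.insert_inter_of_mem hxi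
      · intro t ht
        obtain ⟨s, hs, rfl⟩ := Finset.mem_image.1 ht
        rw [Finset.mem_nonMemberSubfamily] at hs ⊢
        exact ⟨Finset.mem_image.2 ⟨s, hs.1, rfl⟩, fun h => hs.2 (Finset.mem_inter.1 h).1⟩
    rw [← Finset.card_memberSubfamily_add_card_nonMemberSubfamily x F]
    refine (aux_step T _ _ k hk (hA x (Finset.mem_insert_self _ _)) _ _
      (∏ i ∈ U, (F.image (fun s => s ∩ A i)).card)
      (h1.trans (Nat.mul_le_mul_right _ (Finset.prod_le_prod' fun i hi => (out i hi).2)))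
      (h0.trans (Nat.mul_le_mul_right _ (Finset.prod_le_prod' fun i hi => (out i hi).1)))).trans ?_
    exact Nat.mul_le_mul_left _ (Finset.prod_le_prod' inn)

/-- An intersecting family of subsets of `A` has at most half of all the subsets. -/
lemma aux_intersecting {α : Type*} [DecidableEq α] (A : Finset α) (T : Finset (Finset α))
    (hT : ∀ s ∈ T, s ⊆ A) (hI : ∀ s ∈ T, ∀ t ∈ T, (s ∩ t).Nonempty) :
    2 * T.card ≤ 2 ^ A.card := by
  have hinj : Set.InjOn (fun s => A \ s) (T : Set (Finset α)) := by
    intro s hs t ht hst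
    have := congrArg (fun u => A \ u) hst
    simpa [Finset.inter_eq_right.2 (hT s hs), Finset.inter_eq_right.2 (hT t ht)] using this
  have hd : Disjoint T (T.image fun s => A \ s) := by
    rw [Finset.disjoint_left]
    intro s hs hs'
    obtain ⟨t, ht, rfl⟩ := Finset.mem_image.1 hs'
    obtain ⟨x, hx⟩ := hI _ hs _ ht
    simp at hx
  rw [two_mul, ← Finset.card_powerset]
  nth_rewrite 2 [← Finset.card_image_of_injOn hinj]
  rw [← Finset.card_union_of_disjoint hd]
  refine Finset.card_le_card (Finset.union_subset ?_ ?_)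
  · intro s hs
    exact Finset.mem_powerset.2 (hT s hs)
  · intro s hs
    obtain ⟨t, ht, rfl⟩ := Finset.mem_image.1 hs
    exact Finset.mem_powerset.2 Finset.sdiff_subset

/-- Number of colourings giving two distinct vertices the same colour. -/
lemma aux_count {n r : ℕ} (hr : 0 < r) (u v : Fin n) (huv : u ≠ v) :
    (Finset.univ.filter fun c : Fin n → Fin r => c u = c v).card = r ^ (n - 1) := by
  have hn : n - 1 + 1 = n := Nat.sub_add_cancel u.pos
  have h : (Finset.univ.filter fun c : Fin n → Fin r => c u = c v).card * r = r ^ (n - 1) * r := by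
    rw [← pow_succ, hn]
    have h1 : Fintype.card (Fin n → Fin r) = r ^ n := by simp
    rw [← h1, ← Finset.card_univ]
    have h2 : (Finset.univ : Finset (Fin r)).card = r := by simp
    trans (Finset.univ.filter fun c : Fin n → Fin r => c u = c v).card *
      (Finset.univ : Finset (Fin r)).card
    · rw [h2]
    rw [← Finset.card_product]
    refine Finset.card_bij' (fun p _ => Function.update p.1 u p.2)
      (fun c _ => (Function.update c u (c v), c u)) ?_ ?_ ?_ ?_
    · intros; simp
    · intro c _
      simp [Function.update_of_ne huv.symm]
    · rintro ⟨c, a⟩ hc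
      have hc' : c u = c v := by simpa using hc
      simp [Function.update_of_ne huv.symm, ← hc']
    · intro c _
      simp
  exact Nat.eq_of_mul_eq_mul_right hr h

/-- An `H`-intersecting family of graphs on `n` vertices has size at most
`2^(C(n,2) - (χ(H) - 1))`, where `χ(H)` is the chromatic number of the
nonempty finite graph `H`. -/
theorem H_intersecting_family_bound {n : ℕ} {V : Type*} [Fintype V]
    (H : SimpleGraph V) (hH : H.edgeSet.Nonempty)
    (𝒢 : Set (SimpleGraph (Fin n)))
    (h : ∀ G₁ ∈ 𝒢, ∀ G₂ ∈ 𝒢, ∃ f : H →g (G₁ ⊓ G₂), Function.Injective f) :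
    𝒢.ncard ≤ 2 ^ (n.choose 2 - (H.chromaticNumber.toNat - 1)) := by
  classical
  rcases 𝒢.eq_empty_or_nonempty with rfl | ⟨G₀, hG₀⟩
  · simp
  obtain ⟨e, he⟩ := hH
  induction e using Sym2.ind with | _ p q =>
  rw [SimpleGraph.mem_edgeSet] at he
  have hn : 0 < n := by
    obtain ⟨f, -⟩ := h G₀ hG₀ G₀ hG₀
    exact (f p).pos
  obtain ⟨χ, hχ⟩ : ∃ m : ℕ, H.chromaticNumber = m :=
    ⟨_, (ENat.natCast_toNat (SimpleGraph.chromaticNumber_ne_top_iff_exists.2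
      ⟨_, H.colorable_of_fintype⟩)).symm⟩
  have hχ2 : 2 ≤ χ := by
    have := SimpleGraph.two_le_chromaticNumber_of_adj he
    rw [hχ] at this
    exact_mod_cast this
  rw [hχ, ENat.toNat_natCast]
  obtain ⟨r, rfl⟩ : ∃ r, χ = r + 1 := ⟨χ - 1, by omega⟩
  have hr : 0 < r := by omega
  rw [Nat.add_sub_cancel]
  have hcol : ¬ H.Colorable r := by
    intro hc
    have := hc.chromaticNumber_le
    rw [hχ] at this
    have : r + 1 ≤ r := by exact_mod_cast this
    omega
  set S : Finset (Sym2 (Fin n)) := (⊤ : SimpleGraph (Fin n)).edgeFinset with hS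
  have hScard : S.card = n.choose 2 := by
    rw [hS, SimpleGraph.card_edgeFinset_top_eq_card_choose_two, Fintype.card_fin]
  set A : (Fin n → Fin r) → Finset (Sym2 (Fin n)) :=
    fun c => S.filter fun e => (e.map c).IsDiag with hAdef
  set F : Finset (Finset (Sym2 (Fin n))) := 𝒢.toFinset.image fun G => G.edgeFinset with hFdef
  have hFcard : F.card = 𝒢.ncard := by
    rw [hFdef, Finset.card_image_of_injective _ (fun G G' hGG => SimpleGraph.edgeFinset_inj.1 hGG),
      Set.ncard_eq_toFinset_card']
  have hFpos : 0 < F.card := by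
    rw [hFcard, Set.ncard_pos]; exact ⟨_, hG₀⟩
  have hFS : ∀ s ∈ F, s ⊆ S := by
    intro s hs
    obtain ⟨G, -, rfl⟩ := Finset.mem_image.1 hs
    exact SimpleGraph.edgeFinset_mono le_top
  have hk : 0 < r ^ (n - 1) := by positivity
  have hcover : ∀ x ∈ S, (Finset.univ.filter fun c => x ∈ A c).card = r ^ (n - 1) := by
    intro x hx
    induction x using Sym2.ind with | _ u v =>
    have huv : u ≠ v := by simpa [hS] using hx
    rw [← aux_count hr u v huv]
    congr 1
    ext c
    simp [hAdef, hx]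
  have hsh := aux_shearer A _ hk S hcover F hFS
  have hint : ∀ c, 2 * (F.image (fun s => s ∩ A c)).card ≤ 2 ^ (A c).card := by
    intro c
    refine aux_intersecting _ _ ?_ ?_
    · intro s hs
      obtain ⟨t, -, rfl⟩ := Finset.mem_image.1 hs
      exact Finset.inter_subset_right
    · intro s hs t ht
      obtain ⟨s, hs', rfl⟩ := Finset.mem_image.1 hs
      obtain ⟨t, ht', rfl⟩ := Finset.mem_image.1 ht
      obtain ⟨G₁, hG₁, rfl⟩ := Finset.mem_image.1 hs'
      obtain ⟨G₂, hG₂, rfl⟩ := Finset.mem_image.1 ht'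
      obtain ⟨f, -⟩ := h G₁ (by simpa using hG₁) G₂ (by simpa using hG₂)
      by_contra hne
      apply hcol
      refine ⟨SimpleGraph.Coloring.mk (fun v => c (f v)) ?_⟩
      intro a b hab heq
      apply hne
      have hadj := f.map_rel hab
      rw [SimpleGraph.inf_adj] at hadj
      have hne' := hadj.1.ne
      refine ⟨s(f a, f b), ?_⟩
      simp [hAdef, hS, hadj.1, hadj.2, heq, hne']
  have hsum : ∑ c, (A c).card = r ^ (n - 1) * n.choose 2 := by
    have h1 : ∀ c, (A c).card = ∑ x ∈ S, if x ∈ A c then 1 else 0 := by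
      intro c
      rw [← Finset.card_filter]
      congr 1
      ext x
      simp only [hAdef, Finset.mem_filter]
      tauto
    simp_rw [h1]
    rw [Finset.sum_comm]
    simp_rw [← Finset.card_filter]
    rw [Finset.sum_congr rfl hcover, Finset.sum_const, hScard, smul_eq_mul, mul_comm]
  have hprod : 2 ^ (r ^ n) * ∏ c, (F.image (fun s => s ∩ A c)).card ≤
      2 ^ (r ^ (n - 1) * n.choose 2) := by
    have := Finset.prod_le_prod' (s := (Finset.univ : Finset (Fin n → Fin r))) fun c _ => hint c
    rw [Finset.prod_mul_distrib, Finset.prod_pow_eq_pow_sum, hsum] at this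
    simpa using this
  have hfin : (2 ^ r * F.card) ^ (r ^ (n - 1)) ≤ (2 ^ n.choose 2) ^ (r ^ (n - 1)) := by
    rw [mul_pow, ← pow_mul, ← pow_mul, mul_comm r, ← pow_succ, Nat.sub_add_cancel hn,
      mul_comm (n.choose 2)]
    exact (Nat.mul_le_mul_left _ hsh).trans hprod
  have hfin' : 2 ^ r * F.card ≤ 2 ^ n.choose 2 :=
    (Nat.pow_le_pow_iff_left hk.ne').1 hfin
  have hrN : r ≤ n.choose 2 := by
    refine (Nat.pow_le_pow_iff_right (a := 2) (by norm_num)).1 ?_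
    exact (Nat.le_mul_of_pos_right _ hFpos).trans hfin'
  rw [← hFcard]
  refine le_of_mul_le_mul_left (a := 2 ^ r) ?_ (by positivity)
  rwa [← pow_add, Nat.add_sub_cancel' hrN]
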